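/- A C*-algebra A is n-subhomogeneous if and only if A embeds as a C*-subalgebra of Mₙ(B) for some abelian C*-algebra B. -/

import Mathlib

noncomputable section

/-- A (nondegenerate, topologically) irreducible representation of a `*`-algebra `A` on a
complex Hilbert space `H`: some operator in the image is nonzero, and the only closed
invariant subspaces are `⊥` and `⊤`. -/
def IsIrreducibleRep {A : Type*} [NonUnitalNonAssocSemiring A] [DistribMulAction ℂ A] [Star A]
    {H : Type*} [NormedAddCommGroup H] [InnerProductSpace ℂ H] [CompleteSpace H]
    (π : A →⋆ₙₐ[ℂ] (H →L[ℂ] H)) : Prop :=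
  (∃ a, π a ≠ 0) ∧
    ∀ S : Submodule ℂ H, IsClosed (S : Set H) →
      (∀ a : A, ∀ v ∈ S, π a v ∈ S) → S = ⊥ ∨ S = ⊤

/-- A `*`-algebra is `n`-subhomogeneous if all its irreducible representations (on complex
Hilbert spaces) have dimension at most `n`. -/
def IsSubhomogeneous (n : ℕ) (A : Type*) [NonUnitalNonAssocSemiring A]
    [DistribMulAction ℂ A] [Star A] : Prop :=
  ∀ (H : Type) [NormedAddCommGroup H] [InnerProductSpace ℂ H] [CompleteSpace H]
    (π : A →⋆ₙₐ[ℂ] (H →L[ℂ] H)), IsIrreducibleRep π → Module.rank ℂ H ≤ n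

/-- A witness that `A` embeds as a C*-subalgebra of `Mₙ(B)` for some abelian C*-algebra
`B`: the data of such a `B` and an injective `*`-homomorphism `A → Mₙ(B)`.  (The C*-norm
on `Mₙ(B)` is unique, so the embedding is automatically isometric.) -/
structure MatrixEmbeddingWitness (n : ℕ) (A : Type) [NonUnitalCStarAlgebra A] where
  B : Type
  [instB : NonUnitalCStarAlgebra B]
  comm : ∀ x y : B, x * y = y * x
  θ : A →⋆ₙₐ[ℂ] Matrix (Fin n) (Fin n) B
  inj : Function.Injective θ

open scoped ComplexOrder InnerProductSpace ComplexStarModule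

section States

variable {U : Type*} [CStarAlgebra U] [PartialOrder U] [StarOrderedRing U]

/-- Some positive linear functional does not vanish at a given nonzero positive element. -/
theorem exists_positiveLinearMap_apply_ne_zero {x : U} (hx : 0 ≤ x) (hx0 : x ≠ 0) :
    ∃ f : U →ₚ[ℂ] ℂ, f x ≠ 0 := by
  have hneg : -x ∉ ProperCone.positive ℝ U := fun h ↦
    hx0 (le_antisymm (neg_nonneg.mp h) hx)
  obtain ⟨g, hg, hgx⟩ := (ProperCone.positive ℝ U).hyperplane_separation_point hneg
  let F : U →ₗ[ℂ] ℂ :=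
    { toFun := fun y ↦ (g (ℜ y : U) : ℂ) + (g (ℑ y : U) : ℂ) * Complex.I
      map_add' := fun y z ↦ by simp; ring
      map_smul' := fun c y ↦ by
        apply Complex.ext <;> simp [realPart_smul, imaginaryPart_smul] }
  have hF : ∀ y : U, 0 ≤ y → F y = (g y : ℂ) := fun y hy ↦ by
    have hs : IsSelfAdjoint y := .of_nonneg hy
    simp [F, hs.coe_realPart, hs.imaginaryPart]
  refine ⟨.mk₀ F fun y hy ↦ ?_, ?_⟩
  · rw [hF y hy]
    exact_mod_cast hg y hy
  · change F x ≠ 0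
    rw [hF x hx]
    have : g x ≠ 0 := by
      intro h
      simp [h] at hgx
    exact_mod_cast this

theorem PositiveLinearMap.apply_star_mul_self_le (f : U →ₚ[ℂ] ℂ) (x : U) :
    f (star x * x) ≤ (‖x‖ ^ 2 : ℝ) * f 1 := by
  have h := OrderHomClass.mono f (CStarAlgebra.star_mul_le_algebraMap_norm_sq (a := x))
  rwa [Algebra.algebraMap_eq_smul_one, ← Complex.coe_smul, map_smul, smul_eq_mul] at h

theorem PositiveLinearMap.norm_apply_sq_le (f : U →ₚ[ℂ] ℂ) (x : U) :
    ‖f x‖ ^ 2 ≤ ‖x‖ ^ 2 * (f 1).re ^ 2 := by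
  have h := norm_inner_le_norm (𝕜 := ℂ) (f.toPreGNS 1) (f.toPreGNS x)
  have h1 : ‖f.toPreGNS x‖ ^ 2 ≤ ‖x‖ ^ 2 * (f 1).re := by
    have := f.apply_star_mul_self_le x
    rw [← f.ofPreGNS_toPreGNS x, ← f.preGNS_norm_sq, f.ofPreGNS_toPreGNS] at this
    have := (Complex.le_def.1 this).1
    simpa [← Complex.ofReal_pow] using this
  have h2 : ‖f.toPreGNS 1‖ ^ 2 = (f 1).re := by
    have := f.preGNS_norm_sq (f.toPreGNS 1)
    simpa [← Complex.ofReal_pow] using congrArg Complex.re this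
  rw [f.preGNS_inner_def] at h
  simp only [ofPreGNS_toPreGNS, star_one, one_mul] at h
  calc ‖f x‖ ^ 2 ≤ (‖f.toPreGNS 1‖ * ‖f.toPreGNS x‖) ^ 2 := by gcongr
    _ = (f 1).re * ‖f.toPreGNS x‖ ^ 2 := by rw [mul_pow, h2]
    _ ≤ (f 1).re * (‖x‖ ^ 2 * (f 1).re) := by
        gcongr
        exact (Complex.le_def.1 (f.map_nonneg zero_le_one)).1
    _ = _ := by ring

variable (U) in
/-- The state space of a unital C*-algebra, as a set of functions. -/
def stateSpace : Set (U → ℂ) := {φ | ∃ f : U →ₚ[ℂ] ℂ, f 1 = 1 ∧ ⇑f = φ}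

theorem convex_stateSpace : Convex ℝ (stateSpace U) := by
  rintro _ ⟨f, hf, rfl⟩ _ ⟨g, hg, rfl⟩ a b ha hb hab
  refine ⟨.mk₀ ((a : ℂ) • f.toLinearMap + (b : ℂ) • g.toLinearMap) fun x hx ↦ ?_, ?_, ?_⟩
  · have h1 := f.map_nonneg hx
    have h2 := g.map_nonneg hx
    have h3 : (0 : ℂ) ≤ a := by exact_mod_cast ha
    have h4 : (0 : ℂ) ≤ b := by exact_mod_cast hb
    exact add_nonneg (mul_nonneg h3 h1) (mul_nonneg h4 h2)
  · change (a : ℂ) • f 1 + (b : ℂ) • g 1 = 1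
    rw [hf, hg]
    simp only [smul_eq_mul, mul_one]
    exact_mod_cast hab
  · ext x
    change (a : ℂ) • f x + (b : ℂ) • g x = a • f x + b • g x
    simp

theorem isCompact_stateSpace : IsCompact (stateSpace U) := by
  have hbox : IsCompact (Set.univ.pi fun x : U ↦ Metric.closedBall (0 : ℂ) ‖x‖) :=
    isCompact_univ_pi fun x ↦ isCompact_closedBall _ _
  refine hbox.of_isClosed_subset ?_ ?_
  · have : stateSpace U = {φ : U → ℂ | (∀ x y, φ (x + y) = φ x + φ y) ∧
        (∀ (c : ℂ) x, φ (c • x) = c • φ x) ∧ (∀ x, 0 ≤ x → 0 ≤ φ x) ∧ φ 1 = 1} := by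
      ext φ
      constructor
      · rintro ⟨f, hf, rfl⟩
        exact ⟨map_add f, map_smul f, fun x hx ↦ f.map_nonneg hx, hf⟩
      · rintro ⟨h1, h2, h3, h4⟩
        exact ⟨.mk₀ ⟨⟨φ, h1⟩, h2⟩ h3, h4, rfl⟩
    rw [this]
    simp only [Set.ofPred_and, Set.ofPred_forall]
    refine .inter ?_ (.inter ?_ (.inter ?_ ?_))
    · exact isClosed_iInter fun x ↦ isClosed_iInter fun y ↦
        isClosed_eq (by fun_prop) (by fun_prop)
    · exact isClosed_iInter fun c ↦ isClosed_iInter fun x ↦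
        isClosed_eq (by fun_prop) (by fun_prop)
    · exact isClosed_iInter fun x ↦ isClosed_iInter fun _ ↦
        isClosed_le (by fun_prop) (by fun_prop)
    · exact isClosed_eq (by fun_prop) (by fun_prop)
  · rintro _ ⟨f, hf, rfl⟩ x -
    have := f.norm_apply_sq_le x
    rw [hf] at this
    simpa using (sq_le_sq₀ (norm_nonneg _) (norm_nonneg _)).1 (by simpa using this)

/-- Some pure state does not vanish at a given nonzero positive element. -/
theorem exists_extremePoint_stateSpace {x : U} (hx : 0 ≤ x) (hx0 : x ≠ 0) :
    ∃ f : U →ₚ[ℂ] ℂ, f 1 = 1 ∧ ⇑f ∈ (stateSpace U).extremePoints ℝ ∧ f x ≠ 0 := by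
  by_contra! h
  have hvan : stateSpace U ⊆ {φ | φ x = 0} := by
    rw [← closure_convexHull_extremePoints isCompact_stateSpace convex_stateSpace]
    refine closure_minimal (convexHull_min ?_ ?_) (isClosed_eq (by fun_prop) (by fun_prop))
    · intro φ hφ
      obtain ⟨f, hf, rfl⟩ := hφ.1
      exact h f hf hφ
    · intro φ hφ ψ hψ a b _ _ _
      simp_all
  obtain ⟨f, hf⟩ := exists_positiveLinearMap_apply_ne_zero hx hx0
  have h1 : 0 ≤ f 1 := f.map_nonneg zero_le_one
  have h1' : f 1 ≠ 0 := fun h0 ↦ hf <| by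
    have := f.norm_apply_sq_le x
    rw [h0] at this
    simpa using this.antisymm (by simp)
  refine hf ?_
  have := hvan ⟨.mk₀ ((f 1)⁻¹ • f.toLinearMap) fun y hy ↦ ?_, inv_mul_cancel₀ h1', rfl⟩
  · exact (mul_eq_zero.1 this).resolve_left (inv_ne_zero h1')
  · exact mul_nonneg (inv_nonneg.2 h1) (f.map_nonneg hy)

end States

section Irreducible

variable {U : Type*} [CStarAlgebra U] [PartialOrder U] [StarOrderedRing U]

/-- The vector functional `x ↦ ⟪v, π x v⟫` of a representation, as a positive functional. -/
def vectorFunctional {H : Type*} [NormedAddCommGroup H] [InnerProductSpace ℂ H] [CompleteSpace H]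
    (π : U →⋆ₐ[ℂ] (H →L[ℂ] H)) (v : H) : U →ₚ[ℂ] ℂ :=
  .mk₀ ((innerSL ℂ v).toLinearMap ∘ₗ
      (ContinuousLinearMap.apply ℂ H v).toLinearMap ∘ₗ π.toAlgHom.toLinearMap) fun x hx ↦ by
    obtain ⟨y, rfl⟩ := CStarAlgebra.nonneg_iff_eq_star_mul_self.1 hx
    change 0 ≤ ⟪v, π (star y * y) v⟫_ℂ
    rw [map_mul, map_star, ContinuousLinearMap.star_eq_adjoint, mul_apply_eq_comp,
      ContinuousLinearMap.adjoint_inner_right]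
    rw [inner_self_eq_norm_sq_to_K]
    exact Complex.zero_le_real.2 (sq_nonneg ‖π y v‖) |>.trans_eq (Complex.ofReal_pow _ _)

@[simp]
theorem vectorFunctional_apply {H : Type*} [NormedAddCommGroup H] [InnerProductSpace ℂ H]
    [CompleteSpace H] (π : U →⋆ₐ[ℂ] (H →L[ℂ] H)) (v : H) (x : U) :
    vectorFunctional π v x = ⟪v, π x v⟫_ℂ := rfl

/-- A closed subspace invariant under a representation has invariant orthogonal complement. -/
theorem orthogonal_invariant {A : Type*} [NonUnitalNonAssocSemiring A] [DistribMulAction ℂ A]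
    [InvolutiveStar A]
    {H : Type*} [NormedAddCommGroup H] [InnerProductSpace ℂ H] [CompleteSpace H]
    (π : A →⋆ₙₐ[ℂ] (H →L[ℂ] H)) {S : Submodule ℂ H} (hS : ∀ a, ∀ v ∈ S, π a v ∈ S)
    (a : A) {v : H} (hv : v ∈ Sᗮ) : π a v ∈ Sᗮ := by
  rw [Submodule.mem_orthogonal] at hv ⊢
  intro u hu
  rw [← star_star a, map_star, ContinuousLinearMap.star_eq_adjoint,
    ContinuousLinearMap.adjoint_inner_right]
  exact hv _ (hS _ _ hu)

/-- A cyclic vector that induces a pure state only lies in trivial decompositions. -/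
theorem eq_bot_or_eq_top_of_extremePoint
    {H : Type*} [NormedAddCommGroup H] [InnerProductSpace ℂ H] [CompleteSpace H]
    (π : U →⋆ₐ[ℂ] (H →L[ℂ] H)) {ξ : H} (hξ : ‖ξ‖ = 1) (hcyc : DenseRange fun x ↦ π x ξ)
    (hext : ⇑(vectorFunctional π ξ) ∈ (stateSpace U).extremePoints ℝ)
    (S : Submodule ℂ H) (hSc : IsClosed (S : Set H)) (hS : ∀ a, ∀ v ∈ S, π a v ∈ S) :
    S = ⊥ ∨ S = ⊤ := by
  have hSo : ∀ a, ∀ v ∈ Sᗮ, π a v ∈ Sᗮ := fun a v hv ↦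
    orthogonal_invariant (π : U →⋆ₙₐ[ℂ] (H →L[ℂ] H)) hS a hv
  have : CompleteSpace S := hSc.completeSpace_coe
  have top_of_mem : ∀ T : Submodule ℂ H, IsClosed (T : Set H) → (∀ a, ∀ v ∈ T, π a v ∈ T) →
      ξ ∈ T → T = ⊤ := by
    intro T hTc hT hξT
    rw [eq_top_iff]
    intro v _
    have : closure (Set.range fun x ↦ π x ξ) ⊆ T :=
      closure_minimal (by rintro _ ⟨x, rfl⟩; exact hT x ξ hξT) hTc
    exact this (hcyc v)
  obtain ⟨p, hp, q, hq, hpq⟩ := S.exists_add_mem_mem_orthogonal ξ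
  have hort : ∀ u ∈ S, ∀ v ∈ Sᗮ, ⟪u, v⟫_ℂ = 0 := fun u hu v hv ↦
    Submodule.inner_right_of_mem_orthogonal hu hv
  have hort' : ∀ u ∈ S, ∀ v ∈ Sᗮ, ⟪v, u⟫_ℂ = 0 := fun u hu v hv ↦
    Submodule.inner_left_of_mem_orthogonal hu hv
  by_cases hp0 : p = 0
  · left
    have : Sᗮ = ⊤ := top_of_mem _ (Submodule.isClosed_orthogonal S) hSo (by
      rw [hpq, hp0, zero_add]; exact hq)
    exact (Submodule.orthogonal_eq_top_iff S).1 this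
  by_cases hq0 : q = 0
  · right
    exact top_of_mem _ hSc hS (by rw [hpq, hq0, add_zero]; exact hp)
  have hnorm : ‖p‖ ^ 2 + ‖q‖ ^ 2 = 1 := by
    have := norm_add_sq_eq_norm_sq_add_norm_sq_of_inner_eq_zero p q (hort p hp q hq)
    rw [← hpq, hξ] at this
    nlinarith
  have state : ∀ v : H, v ≠ 0 → ∀ φ : U → ℂ,
      (∀ x, φ x = ((‖v‖ ^ 2 : ℝ) : ℂ)⁻¹ * ⟪v, π x v⟫_ℂ) → φ ∈ stateSpace U := by
    intro v hv φ hφ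
    refine ⟨.mk₀ (((‖v‖ ^ 2 : ℝ) : ℂ)⁻¹ • (vectorFunctional π v).toLinearMap) fun x hx ↦ ?_,
      ?_, ?_⟩
    · refine mul_nonneg (inv_nonneg.2 ?_) ((vectorFunctional π v).map_nonneg hx)
      exact_mod_cast sq_nonneg ‖v‖
    · change ((‖v‖ ^ 2 : ℝ) : ℂ)⁻¹ * ⟪v, π 1 v⟫_ℂ = 1
      rw [map_one, one_apply_eq_self, inner_self_eq_norm_sq_to_K]
      simp [hv]
    · exact funext fun x ↦ (hφ x).symm
  have hdecomp : ∀ x, ⟪ξ, π x ξ⟫_ℂ = ⟪p, π x p⟫_ℂ + ⟪q, π x q⟫_ℂ := fun x ↦ by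
    rw [hpq, map_add, inner_add_left, inner_add_right, inner_add_right,
      hort p hp _ (hSo x q hq), hort' _ (hS x p hp) q hq]
    ring
  have hp' : ((‖p‖ ^ 2 : ℝ) : ℂ) ≠ 0 := by simpa using hp0
  have hq' : ((‖q‖ ^ 2 : ℝ) : ℂ) ≠ 0 := by simpa using hq0
  have key := hext.2 (state p hp0 _ fun x ↦ rfl) (state q hq0 _ fun x ↦ rfl)
    ⟨‖p‖ ^ 2, ‖q‖ ^ 2, by positivity, by positivity, hnorm, by
      ext x
      simp only [Pi.add_apply, Pi.smul_apply, vectorFunctional_apply, hdecomp,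
        Complex.real_smul]
      rw [mul_inv_cancel_left₀ hp', mul_inv_cancel_left₀ hq']⟩
  have hzero : p - ((‖p‖ ^ 2 : ℝ) : ℂ) • ξ = 0 := by
    refine hcyc.eq_zero_of_inner_left ℂ fun x ↦ ?_
    have hx : ((‖p‖ ^ 2 : ℝ) : ℂ)⁻¹ * ⟪p, π x p⟫_ℂ = ⟪ξ, π x ξ⟫_ℂ := congrFun key x
    have hpx : ⟪p, π x ξ⟫_ℂ = ⟪p, π x p⟫_ℂ := by
      rw [hpq, map_add, inner_add_right, hort p hp _ (hSo x q hq), add_zero]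
    rw [inner_sub_left, inner_smul_left, Complex.conj_ofReal, ← hx, mul_inv_cancel_left₀ hp', hpx,
      sub_self]
  right
  refine top_of_mem S hSc hS ?_
  have : ξ = ((‖p‖ ^ 2 : ℝ) : ℂ)⁻¹ • p := by
    rw [eq_inv_smul_iff₀ hp']
    exact (sub_eq_zero.1 hzero).symm
  rw [this]
  exact S.smul_mem _ hp

end Irreducible

section GNS

variable {U : Type*} [CStarAlgebra U] [PartialOrder U] [StarOrderedRing U]

theorem PositiveLinearMap.gnsStarAlgHom_apply_one (f : U →ₚ[ℂ] ℂ) (x : U) :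
    f.gnsStarAlgHom x ((f.toPreGNS 1 : f.PreGNS) : f.GNS) = (f.toPreGNS x : f.PreGNS) := by
  change f.gnsNonUnitalStarAlgHom x _ = _
  rw [f.gnsNonUnitalStarAlgHom_apply_coe]
  simp

theorem PositiveLinearMap.vectorFunctional_gns (f : U →ₚ[ℂ] ℂ) :
    vectorFunctional f.gnsStarAlgHom ((f.toPreGNS 1 : f.PreGNS) : f.GNS) = f := by
  ext x
  rw [vectorFunctional_apply, f.gnsStarAlgHom_apply_one, UniformSpace.Completion.inner_coe,
    f.preGNS_inner_def]
  simp

/-- The irreducible representations of a C*-algebra separate its points. -/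
theorem exists_irreducibleRep_apply_ne_zero {A : Type} [NonUnitalCStarAlgebra A] {a : A}
    (ha : a ≠ 0) : ∃ (H : Type) (_ : NormedAddCommGroup H) (_ : InnerProductSpace ℂ H)
      (_ : CompleteSpace H) (π : A →⋆ₙₐ[ℂ] (H →L[ℂ] H)), IsIrreducibleRep π ∧ π a ≠ 0 := by
  let _ : PartialOrder (Unitization ℂ A) := CStarAlgebra.spectralOrder _
  have _ : StarOrderedRing (Unitization ℂ A) := CStarAlgebra.spectralOrderedRing _
  have hx0 : star (a : Unitization ℂ A) * a ≠ 0 := by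
    rw [Ne, CStarRing.star_mul_self_eq_zero_iff]
    exact fun h ↦ ha (Unitization.inr_injective (by simpa using h))
  obtain ⟨f, hf1, hfext, hfa⟩ := exists_extremePoint_stateSpace
    (star_mul_self_nonneg (a : Unitization ℂ A)) hx0
  let ξ : f.GNS := (f.toPreGNS 1 : f.PreGNS)
  let π : A →⋆ₙₐ[ℂ] (f.GNS →L[ℂ] f.GNS) :=
    (f.gnsStarAlgHom : Unitization ℂ A →⋆ₙₐ[ℂ] (f.GNS →L[ℂ] f.GNS)).comp
      (Unitization.inrNonUnitalStarAlgHom ℂ A)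
  have hπ : ∀ b : A, π b = f.gnsStarAlgHom (b : Unitization ℂ A) := fun b ↦ rfl
  have hπa : π a ≠ 0 := by
    intro h
    rw [hπ] at h
    apply hfa
    rw [← f.vectorFunctional_gns, vectorFunctional_apply, map_mul, h]
    simp
  refine ⟨f.GNS, inferInstance, inferInstance, inferInstance, π, ⟨⟨a, hπa⟩, ?_⟩, hπa⟩
  intro S hSc hS
  refine eq_bot_or_eq_top_of_extremePoint f.gnsStarAlgHom (ξ := ξ) ?_ ?_ ?_ S hSc ?_
  · have := f.preGNS_norm_sq (f.toPreGNS 1)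
    simp only [PositiveLinearMap.ofPreGNS_toPreGNS, star_one, one_mul, hf1] at this
    rw [UniformSpace.Completion.norm_coe]
    have h2 : ‖f.toPreGNS 1‖ ^ 2 = 1 := by exact_mod_cast this
    exact (pow_eq_one_iff_of_nonneg (norm_nonneg _) two_ne_zero).1 h2
  · have : (fun x ↦ f.gnsStarAlgHom x ξ) =
        ((↑) : f.PreGNS → f.GNS) ∘ f.toPreGNS := funext f.gnsStarAlgHom_apply_one
    rw [this]
    exact UniformSpace.Completion.denseRange_coe.comp f.toPreGNS.surjective.denseRange
      (UniformSpace.Completion.continuous_coe _)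
  · rw [f.vectorFunctional_gns]
    exact hfext
  · intro x v hv
    induction x with
    | inl_add_inr c b =>
      rw [map_add, add_apply]
      refine S.add_mem ?_ (hS b v hv)
      rw [← Unitization.algebraMap_eq_inl, AlgHomClass.commutes]
      exact S.smul_mem c hv

end GNS

section Embedding

/-- Compressing operators to matrices with a finite Parseval frame is multiplicative. -/
theorem parseval_mul {ι H : Type*} [Fintype ι] [NormedAddCommGroup H] [InnerProductSpace ℂ H]
    {v : ι → H} (hv : ∀ x, ∑ k, ⟪v k, x⟫_ℂ • v k = x) (S T : H →L[ℂ] H) (i j : ι) :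
    ⟪v i, (S * T) (v j)⟫_ℂ = ∑ k, ⟪v i, S (v k)⟫_ℂ * ⟪v k, T (v j)⟫_ℂ := by
  conv_lhs => rw [mul_apply_eq_comp, ← hv (T (v j)), map_sum, inner_sum]
  simp [inner_smul_right, mul_comm]

theorem exists_parseval_frame {H : Type*} [NormedAddCommGroup H] [InnerProductSpace ℂ H] {n : ℕ}
    (hn : Module.rank ℂ H ≤ n) :
    ∃ v : Fin n → H, (∀ i, ‖v i‖ ≤ 1) ∧ ∀ x, ∑ k, ⟪v k, x⟫_ℂ • v k = x := by
  have : FiniteDimensional ℂ H := Module.rank_lt_aleph0_iff.1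
    (hn.trans_lt (Cardinal.natCast_lt_aleph0))
  let b := stdOrthonormalBasis ℂ H
  have hd : Module.finrank ℂ H ≤ n := Module.finrank_le_of_rank_le hn
  let v : Fin n → H := fun i ↦ if h : (i : ℕ) < Module.finrank ℂ H then b ⟨i, h⟩ else 0
  refine ⟨v, fun i ↦ ?_, fun x ↦ ?_⟩
  · simp only [v]
    split_ifs
    · exact (b.norm_eq_one _).le
    · simp
  · conv_rhs => rw [← b.sum_repr' x]
    refine (Finset.sum_of_injOn (Fin.castLE hd) ?_ ?_ ?_ ?_).symm
    · exact (Fin.castLE_injective hd).injOn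
    · simp
    · intro i _ hi
      have : ¬ (i : ℕ) < Module.finrank ℂ H := fun h ↦
        hi ⟨⟨i, h⟩, by simp, by ext; simp⟩
      simp [v, this]
    · intro i _
      simp [v]

theorem IsSubhomogeneous.nonempty_matrixEmbeddingWitness {n : ℕ} {A : Type}
    [NonUnitalCStarAlgebra A] (h : IsSubhomogeneous n A) :
    Nonempty (MatrixEmbeddingWitness n A) := by
  have hrep : ∀ a : {a : A // a ≠ 0}, ∃ (H : Type) (_ : NormedAddCommGroup H)
      (_ : InnerProductSpace ℂ H) (_ : CompleteSpace H) (π : A →⋆ₙₐ[ℂ] (H →L[ℂ] H))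
      (v : Fin n → H), π a ≠ 0 ∧ (∀ i, ‖v i‖ ≤ 1) ∧ ∀ x, ∑ k, ⟪v k, x⟫_ℂ • v k = x := by
    rintro ⟨a, ha⟩
    obtain ⟨H, _, _, _, π, hπ, hπa⟩ := exists_irreducibleRep_apply_ne_zero ha
    obtain ⟨v, hv1, hv⟩ := exists_parseval_frame (h H π hπ)
    exact ⟨H, _, _, ‹_›, π, v, hπa, hv1, hv⟩
  choose H _ _ _ π v hπ hv1 hv using hrep
  let _ : TopologicalSpace {a : A // a ≠ 0} := ⊥
  have _ : DiscreteTopology {a : A // a ≠ 0} := ⟨rfl⟩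
  let θ : A → Matrix (Fin n) (Fin n) (BoundedContinuousFunction {a : A // a ≠ 0} ℂ) :=
    fun a ↦ .of fun i j ↦ BoundedContinuousFunction.ofNormedAddCommGroupDiscrete
      (fun s ↦ ⟪v s i, π s a (v s j)⟫_ℂ) ‖a‖ fun s ↦ by
        calc ‖⟪v s i, π s a (v s j)⟫_ℂ‖ ≤ ‖v s i‖ * (‖π s a‖ * ‖v s j‖) :=
              (norm_inner_le_norm _ _).trans (by gcongr; exact (π s a).le_opNorm _)
          _ ≤ 1 * (‖a‖ * 1) := by
              gcongr
              exacts [hv1 s i, NonUnitalStarAlgHom.norm_apply_le (π s) a, hv1 s j]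
          _ = ‖a‖ := by simp
  have hθ : ∀ a i j s, θ a i j s = ⟪v s i, π s a (v s j)⟫_ℂ := fun _ _ _ _ ↦ rfl
  refine ⟨{
    B := BoundedContinuousFunction {a : A // a ≠ 0} ℂ
    comm := mul_comm
    θ :=
      { toFun := θ
        map_smul' := fun c a ↦ by
          ext i j s
          simp [hθ]
        map_zero' := by
          ext i j s
          simp [hθ]
        map_add' := fun a b ↦ by
          ext i j s
          simp [hθ]
        map_mul' := fun a b ↦ by
          ext i j s
          simpa [hθ, Matrix.mul_apply] using parseval_mul (hv s) (π s a) (π s b) i j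
        map_star' := fun a ↦ by
          ext i j s
          have : ⟪v s i, π s (star a) (v s j)⟫_ℂ = ⟪π s a (v s i), v s j⟫_ℂ := by
            rw [map_star (π s), ContinuousLinearMap.star_eq_adjoint,
              ContinuousLinearMap.adjoint_inner_right]
          simpa [hθ, Matrix.star_apply] using this }
    inj := ?_ }⟩
  refine (injective_iff_map_eq_zero _).2 fun a ha ↦ ?_
  by_contra ha0
  refine hπ ⟨a, ha0⟩ (ContinuousLinearMap.ext fun x ↦ ?_)
  have hz : ∀ i j, ⟪v ⟨a, ha0⟩ i, π ⟨a, ha0⟩ a (v ⟨a, ha0⟩ j)⟫_ℂ = 0 := fun i j ↦ by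
    rw [← hθ]
    have : θ a = 0 := ha
    simp [this]
  have hz' : ∀ j, π ⟨a, ha0⟩ a (v ⟨a, ha0⟩ j) = 0 := fun j ↦ by
    rw [← hv ⟨a, ha0⟩ (π ⟨a, ha0⟩ a (v ⟨a, ha0⟩ j))]
    simp [hz]
  rw [← hv ⟨a, ha0⟩ x, map_sum]
  simp [hz']

end Embedding

section Density

section Diagonal

variable {H : Type*} [NormedAddCommGroup H] [InnerProductSpace ℂ H]

/-- The diagonal action of an operator on a finite direct sum of copies of a Hilbert space. -/
def diagonalOperator (ι : Type*) [Fintype ι] :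
    (H →L[ℂ] H) →ₗ[ℂ] (PiLp 2 fun _ : ι ↦ H) →L[ℂ] (PiLp 2 fun _ : ι ↦ H) where
  toFun T := (PiLp.continuousLinearEquiv 2 ℂ fun _ : ι ↦ H).symm.toContinuousLinearMap ∘L
    ContinuousLinearMap.pi fun i ↦ T ∘L PiLp.proj 2 (fun _ : ι ↦ H) i
  map_add' _ _ := by ext; simp
  map_smul' _ _ := by ext; simp

@[simp]
theorem diagonalOperator_apply {ι : Type*} [Fintype ι] (T : H →L[ℂ] H) (x : PiLp 2 fun _ : ι ↦ H)
    (i : ι) : diagonalOperator ι T x i = T (x i) := rfl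

end Diagonal

variable {A : Type*} [NonUnitalCStarAlgebra A]
  {H : Type*} [NormedAddCommGroup H] [InnerProductSpace ℂ H] [CompleteSpace H]
  {π : A →⋆ₙₐ[ℂ] (H →L[ℂ] H)}

/-- For an irreducible representation, the product of two nonzero operators is nonzero
if the first one commutes with the representation. -/
theorem IsIrreducibleRep.eq_zero_or_eq_zero_of_mul_eq_zero (hπ : IsIrreducibleRep π)
    {S T : H →L[ℂ] H} (hS : ∀ a, Commute (π a) S) (hST : S * T = 0) : S = 0 ∨ T = 0 := by
  have hinv : ∀ a, ∀ v ∈ S.ker, π a v ∈ S.ker := fun a v hv ↦ by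
    have h1 : S v = 0 := hv
    have h2 : π a (S v) = S (π a v) := congrArg (fun R : H →L[ℂ] H ↦ R v) (hS a)
    change S (π a v) = 0
    rw [← h2, h1, map_zero]
  rcases hπ.2 S.ker S.isClosed_ker hinv with h | h
  · right
    ext v
    have : T v ∈ S.ker := congrArg (fun R : H →L[ℂ] H ↦ R v) hST
    rw [h] at this
    simpa using this
  · left
    ext v
    have : v ∈ S.ker := h ▸ Submodule.mem_top
    simpa using this

theorem IsIrreducibleRep.exists_eq_smul_one_of_isSelfAdjoint (hπ : IsIrreducibleRep π)
    {T : H →L[ℂ] H} (hT : ∀ a, Commute (π a) T) (hsa : IsSelfAdjoint T) :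
    ∃ c : ℂ, T = c • 1 := by
  obtain ⟨a, ha⟩ := hπ.1
  have hnt : Nontrivial (H →L[ℂ] H) := ⟨⟨_, _, ha⟩⟩
  obtain ⟨c, hc⟩ : (spectrum ℝ T).Nonempty :=
    ContinuousFunctionalCalculus.spectrum_nonempty T hsa
  have ne_zero : ∀ f : ℝ → ℝ, Continuous f → ∀ x ∈ spectrum ℝ T, f x ≠ 0 → cfc f T ≠ 0 := by
    intro f hf x hx hfx h0
    have : f x ∈ spectrum ℝ (cfc f T) := by
      rw [cfc_map_spectrum f T hsa hf.continuousOn]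
      exact ⟨x, hx, rfl⟩
    rw [h0, spectrum.zero_eq] at this
    exact hfx this
  have no_gap : ∀ x ∈ spectrum ℝ T, ∀ y ∈ spectrum ℝ T, ¬ x < y := by
    intro x hx y hy hxy
    let m := (x + y) / 2
    have hf : Continuous fun t : ℝ ↦ max (t - m) 0 := by fun_prop
    have hg : Continuous fun t : ℝ ↦ max (m - t) 0 := by fun_prop
    have hfg : cfc (fun t : ℝ ↦ max (t - m) 0) T * cfc (fun t : ℝ ↦ max (m - t) 0) T = 0 := by
      rw [← cfc_mul _ _ T hf.continuousOn hg.continuousOn, ← cfc_const_zero ℝ T]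
      congr 1
      ext t
      rcases le_total t m with h | h
      · rw [max_eq_right (sub_nonpos.2 h), zero_mul]
      · rw [max_eq_right (sub_nonpos.2 h), mul_zero]
    rcases hπ.eq_zero_or_eq_zero_of_mul_eq_zero
      (fun a ↦ ((hT a).symm.cfc_real _).symm) hfg with h | h
    · refine ne_zero _ hf y hy ?_ h
      have : 0 < y - m := by simp only [m]; linarith
      exact (lt_max_of_lt_left this).ne'
    · refine ne_zero _ hg x hx ?_ h
      have : 0 < m - x := by simp only [m]; linarith
      exact (lt_max_of_lt_left this).ne'
  refine ⟨(c : ℂ), ?_⟩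
  calc T = cfc (id : ℝ → ℝ) T := (cfc_id ℝ T hsa).symm
    _ = cfc (fun _ : ℝ ↦ c) T := cfc_congr fun x hx ↦
        le_antisymm (not_lt.1 (no_gap c hc x hx)) (not_lt.1 (no_gap x hx c hc))
    _ = algebraMap ℝ _ c := cfc_const c T hsa
    _ = (c : ℂ) • 1 := by rw [Algebra.algebraMap_eq_smul_one, Complex.coe_smul]

/-- Schur's lemma for irreducible representations on Hilbert spaces. -/
theorem IsIrreducibleRep.exists_eq_smul_one (hπ : IsIrreducibleRep π)
    {T : H →L[ℂ] H} (hT : ∀ a, Commute (π a) T) : ∃ c : ℂ, T = c • 1 := by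
  have hT' : ∀ a, Commute (π a) (star T) := fun a ↦ by
    have := (hT (star a)).star_star
    rwa [map_star π, star_star] at this
  obtain ⟨c, hc⟩ := hπ.exists_eq_smul_one_of_isSelfAdjoint (T := (ℜ T : H →L[ℂ] H))
    (fun a ↦ by
      rw [realPart_apply_coe]
      exact ((hT a).add_right (hT' a)).smul_right _) (ℜ T).2
  obtain ⟨d, hd⟩ := hπ.exists_eq_smul_one_of_isSelfAdjoint (T := (ℑ T : H →L[ℂ] H))
    (fun a ↦ by
      rw [imaginaryPart_apply_coe]
      exact (((hT a).sub_right (hT' a)).smul_right _).smul_right _) (ℑ T).2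
  refine ⟨c + Complex.I * d, ?_⟩
  rw [← realPart_add_I_smul_imaginaryPart T, hc, hd, smul_smul, add_smul]

theorem IsIrreducibleRep.eq_zero_of_forall_apply_eq_zero (hπ : IsIrreducibleRep π) {v : H}
    (hv : ∀ a, π a v = 0) : v = 0 := by
  let K : Submodule ℂ H := ⨅ a, (π a).ker
  have hK : ∀ x, x ∈ K ↔ ∀ a, π a x = 0 := fun x ↦ by simp [K]
  have hK_closed : IsClosed (K : Set H) := by
    simp only [K, Submodule.coe_iInf]
    exact isClosed_iInter fun a ↦ (π a).isClosed_ker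
  have hK_inv : ∀ a, ∀ x ∈ K, π a x ∈ K := fun a x hx ↦ by
    rw [hK] at hx ⊢
    intro b
    rw [hx a, map_zero]
  rcases hπ.2 K hK_closed hK_inv with h | h
  · have := (hK v).2 hv
    rwa [h, Submodule.mem_bot] at this
  · obtain ⟨a, ha⟩ := hπ.1
    refine absurd (ContinuousLinearMap.ext fun x ↦ ?_) ha
    exact (hK x).1 (h ▸ Submodule.mem_top) a

/-- A weak-operator continuous functional that vanishes on the image of an irreducible
representation vanishes on all operators. -/
theorem IsIrreducibleRep.sum_inner_eq_zero (hπ : IsIrreducibleRep π) {ι : Type*} [Fintype ι]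
    {u v : ι → H} (h : ∀ a, ∑ i, ⟪u i, π a (v i)⟫_ℂ = 0) (T : H →L[ℂ] H) :
    ∑ i, ⟪u i, T (v i)⟫_ℂ = 0 := by
  classical
  let D := diagonalOperator (H := H) ι
  let x : PiLp 2 fun _ : ι ↦ H := WithLp.toLp 2 v
  let y : PiLp 2 fun _ : ι ↦ H := WithLp.toLp 2 u
  let K : Submodule ℂ (PiLp 2 fun _ : ι ↦ H) :=
    (Submodule.span ℂ (Set.range fun a ↦ D (π a) x)).topologicalClosure
  have hK_le : ∀ L : Submodule ℂ (PiLp 2 fun _ : ι ↦ H), IsClosed (L : Set (PiLp 2 fun _ : ι ↦ H)) →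
      (∀ a, D (π a) x ∈ L) → K ≤ L := fun L hL h ↦
    Submodule.topologicalClosure_minimal _ (Submodule.span_le.2 (by rintro _ ⟨a, rfl⟩; exact h a))
      hL
  have hKc : IsClosed (K : Set (PiLp 2 fun _ : ι ↦ H)) := Submodule.isClosed_topologicalClosure _
  have hK_mem : ∀ a, D (π a) x ∈ K := fun a ↦
    Submodule.le_topologicalClosure _ (Submodule.subset_span ⟨a, rfl⟩)
  have hK_inv : ∀ a, ∀ z ∈ K, D (π a) z ∈ K := fun a ↦
    hK_le (K.comap (D (π a)).toLinearMap) (hKc.preimage (D (π a)).continuous) fun b ↦ by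
      have : D (π a) (D (π b) x) = D (π (a * b)) x := by
        ext i
        simp [D]
      rw [Submodule.mem_comap]
      exact this.symm ▸ hK_mem (a * b)
  have hKo_inv : ∀ a, ∀ z ∈ Kᗮ, D (π a) z ∈ Kᗮ := fun a z hz ↦ by
    rw [Submodule.mem_orthogonal] at hz ⊢
    intro w hw
    rw [← hz _ (hK_inv (star a) w hw), PiLp.inner_apply, PiLp.inner_apply]
    refine Finset.sum_congr rfl fun i _ ↦ ?_
    simp only [D, diagonalOperator_apply]
    rw [map_star π, ContinuousLinearMap.star_eq_adjoint, ContinuousLinearMap.adjoint_inner_left]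
  have : CompleteSpace K := hKc.completeSpace_coe
  let P := K.starProjection
  have hPK : ∀ z ∈ K, P z = z := fun z hz ↦ Submodule.starProjection_eq_self_iff.2 hz
  have hP_mem : ∀ z, P z ∈ K := fun z ↦ Submodule.starProjection_apply_mem K z
  have hPKo : ∀ z ∈ Kᗮ, P z = 0 := fun z hz ↦ (Submodule.starProjection_apply_eq_zero_iff _).2 hz
  have hP_comm : ∀ a z, P (D (π a) z) = D (π a) (P z) := fun a z ↦ by
    have hz : z = P z + (z - P z) := by abel
    have hzo : z - P z ∈ Kᗮ := Submodule.sub_starProjection_mem_orthogonal z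
    conv_lhs => rw [hz, map_add, map_add, hPK _ (hK_inv a _ (hP_mem z)),
      hPKo _ (hKo_inv a _ hzo), add_zero]
  let incl : ι → H →L[ℂ] PiLp 2 fun _ : ι ↦ H := fun j ↦
    (PiLp.continuousLinearEquiv 2 ℂ fun _ : ι ↦ H).symm.toContinuousLinearMap ∘L
      ContinuousLinearMap.single ℂ (fun _ : ι ↦ H) j
  have hincl : ∀ (S : H →L[ℂ] H) j w, incl j (S w) = D S (incl j w) := fun S j w ↦ by
    ext i
    by_cases hij : i = j
    · subst hij; simp [incl, D]
    · simp [incl, D, hij]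
  have hsum : ∀ z : PiLp 2 fun _ : ι ↦ H, z = ∑ j, incl j (z j) := fun z ↦ by
    ext i
    simp [incl, Finset.sum_apply, Pi.single_apply]
  have hscalar : ∀ i j, ∃ c : ℂ, PiLp.proj 2 (fun _ : ι ↦ H) i ∘L P ∘L incl j = c • 1 :=
    fun i j ↦ hπ.exists_eq_smul_one fun a ↦ by
      ext w
      have := congrArg (fun z : PiLp 2 fun _ : ι ↦ H ↦ z i) (hP_comm a (incl j w))
      simp only [← hincl] at this
      exact this.symm
  choose c hc using hscalar
  have hP_apply : ∀ z i, P z i = ∑ j, c i j • z j := fun z i ↦ by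
    conv_lhs => rw [hsum z, map_sum]
    have : ∀ j, P (incl j (z j)) i = c i j • z j := fun j ↦
      congrArg (fun R : H →L[ℂ] H ↦ R (z j)) (hc i j)
    simp [this]
  have hPT : P (D T x) = D T (P x) := by
    ext i
    simp only [hP_apply, D, diagonalOperator_apply, map_sum, map_smul]
  have hxK : P x = x := by
    have : ∀ a, D (π a) (x - P x) = 0 := fun a ↦ by
      rw [map_sub, ← hP_comm, hPK _ (hK_mem a), sub_self]
    have : x - P x = 0 := by
      ext i
      exact hπ.eq_zero_of_forall_apply_eq_zero fun a ↦
        congrArg (fun z : PiLp 2 fun _ : ι ↦ H ↦ z i) (this a)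
    exact (sub_eq_zero.1 this).symm
  have hDT : D T x ∈ K := by
    rw [← hxK, ← hPT]
    exact hP_mem _
  have hKy : K ≤ (innerSL ℂ y).ker :=
    hK_le _ (innerSL ℂ y).isClosed_ker fun a ↦ by
      simpa [PiLp.inner_apply, D, x, y] using h a
  simpa [PiLp.inner_apply, D, x, y] using hKy hDT

/-- A sum of two-sided multiplications that vanishes on the image of an irreducible
representation vanishes on all operators. -/
theorem IsIrreducibleRep.sum_mul_mul_eq_zero (hπ : IsIrreducibleRep π) {κ : Type*} [Fintype κ]
    {L R : κ → H →L[ℂ] H} (h : ∀ a, ∑ k, L k * π a * R k = 0) (T : H →L[ℂ] H) :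
    ∑ k, L k * T * R k = 0 := by
  have key : ∀ (u v : H) (S : H →L[ℂ] H), ⟪u, (∑ k, L k * S * R k) v⟫_ℂ =
      ∑ k, ⟪(L k).adjoint u, S (R k v)⟫_ℂ := fun u v S ↦ by
    simp [ContinuousLinearMap.adjoint_inner_left, sum_apply]
  ext v
  refine ext_inner_left ℂ fun u ↦ ?_
  rw [key, zero_apply, inner_zero_right]
  refine hπ.sum_inner_eq_zero (fun a ↦ ?_) T
  rw [← key, h a]
  simp

/-- A multilinear identity satisfied by the image of an irreducible representation is
satisfied by all operators. -/
theorem IsIrreducibleRep.sum_smul_prod_eq_zero (hπ : IsIrreducibleRep π) {ι κ : Type*}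
    [Finite ι] [Fintype κ] {c : κ → ℤ} {w : κ → List ι} (hnodup : ∀ k, (w k).Nodup)
    (hmem : ∀ k i, i ∈ w k) (h : ∀ f : ι → A, ∑ k, c k • ((w k).map fun i ↦ π (f i)).prod = 0)
    (f : ι → H →L[ℂ] H) : ∑ k, c k • ((w k).map f).prod = 0 := by
  classical
  have := Fintype.ofFinite ι
  suffices ∀ s : Finset ι, ∀ f : ι → H →L[ℂ] H, (∀ i ∉ s, ∃ a, π a = f i) →
      ∑ k, c k • ((w k).map f).prod = 0 from this Finset.univ f (by simp)
  intro s
  induction s using Finset.induction_on with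
  | empty =>
    intro f hf
    choose g hg using fun i ↦ hf i (Finset.notMem_empty i)
    simpa only [hg] using h g
  | insert j s _ ih =>
    intro f hf
    choose l₁ l₂ hl using fun k ↦ List.append_of_mem (hmem k j)
    have hsplit : ∀ T : H →L[ℂ] H, ∑ k, c k • ((w k).map (Function.update f j T)).prod =
        ∑ k, (c k • ((l₁ k).map f).prod) * T * ((l₂ k).map f).prod := fun T ↦ by
      refine Finset.sum_congr rfl fun k _ ↦ ?_
      have hn := hnodup k
      rw [hl k, List.nodup_append] at hn
      have h₁ : ∀ i ∈ l₁ k, i ≠ j := fun i hi ↦ hn.2.2 i hi j (by simp)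
      have h₂ : ∀ i ∈ l₂ k, i ≠ j := fun i hi hij ↦ (List.nodup_cons.1 hn.2.1).1 (hij ▸ hi)
      rw [hl k, List.map_append, List.map_cons, List.prod_append, List.prod_cons,
        List.map_congr_left fun i hi ↦ Function.update_of_ne (h₁ i hi) T f,
        List.map_congr_left fun i hi ↦ Function.update_of_ne (h₂ i hi) T f,
        Function.update_self, smul_mul_assoc, smul_mul_assoc, mul_assoc]
    have := hπ.sum_mul_mul_eq_zero (fun a ↦ (hsplit (π a)).symm.trans <| ih _ fun i hi ↦ ?_) (f j)
    · rwa [← hsplit, Function.update_eq_self] at this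
    · by_cases hij : i = j
      · subst hij
        exact ⟨a, by simp⟩
      · obtain ⟨b, hb⟩ := hf i (by simp [hij, hi])
        exact ⟨b, by simp [hij, hb]⟩

end Density

section Capelli

/-- The word `(0, 0) (σ 0, 1) (0, 2) (1, 0) (σ 1, 1) (1, 2) ⋯` of the monomial of the Capelli
polynomial that belongs to the permutation `σ`. -/
def capelliWord {m : ℕ} (σ : Equiv.Perm (Fin m)) : List (Fin m × Fin 3) :=
  (List.finRange m).flatMap fun k ↦ [(k, 0), (σ k, 1), (k, 2)]

theorem mem_capelliWord {m : ℕ} (σ : Equiv.Perm (Fin m)) (i : Fin m × Fin 3) :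
    i ∈ capelliWord σ := by
  obtain ⟨k, j⟩ := i
  fin_cases j
  · simp [capelliWord]
  · simp only [capelliWord, List.mem_flatMap]
    exact ⟨σ.symm k, List.mem_finRange _, by simp⟩
  · simp [capelliWord]

theorem nodup_capelliWord {m : ℕ} (σ : Equiv.Perm (Fin m)) : (capelliWord σ).Nodup := by
  rw [capelliWord, List.nodup_flatMap]
  refine ⟨fun k _ ↦ by simp, (List.nodup_finRange m).imp fun {a b} hab ↦ ?_⟩
  simp [Function.onFun, hab.symm]

theorem prod_map_capelliWord {M : Type*} [Monoid M] {m : ℕ} (σ : Equiv.Perm (Fin m))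
    (f : Fin m × Fin 3 → M) : ((capelliWord σ).map f).prod =
      (List.ofFn fun k ↦ f (k, 0) * f (σ k, 1) * f (k, 2)).prod := by
  rw [capelliWord, List.map_flatMap, List.ofFn_eq_map]
  induction List.finRange m with
  | nil => simp
  | cons a l ih => rw [List.flatMap_cons, List.prod_append, ih]; simp [mul_assoc]

theorem map_sum_sign_smul_prod_capelliWord {F R S : Type*} [Ring R] [Ring S]
    [FunLike F R S] [RingHomClass F R S] (φ : F) {m : ℕ} (f : Fin m × Fin 3 → R) :
    φ (∑ σ : Equiv.Perm (Fin m), (Equiv.Perm.sign σ : ℤ) • ((capelliWord σ).map f).prod) =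
      ∑ σ : Equiv.Perm (Fin m),
        (Equiv.Perm.sign σ : ℤ) • ((capelliWord σ).map fun i ↦ φ (f i)).prod := by
  simp [map_list_prod, List.map_map, Function.comp_def]

/-- The Capelli polynomial of degree `m` vanishes on `n × n` matrices over a commutative ring
if `m > n ^ 2`. -/
theorem Matrix.sum_sign_smul_prod_capelliWord {C : Type*} [CommRing C] {n m : ℕ}
    (hm : n * n < m) (f : Fin m × Fin 3 → Matrix (Fin n) (Fin n) C) :
    ∑ σ : Equiv.Perm (Fin m), (Equiv.Perm.sign σ : ℤ) • ((capelliWord σ).map f).prod = 0 := by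
  let μ := (MultilinearMap.mkPiAlgebraFin C m (Matrix (Fin n) (Fin n) C)).compLinearMap
    fun k ↦ LinearMap.mulLeft C (f (k, 0)) ∘ₗ LinearMap.mulRight C (f (k, 2))
  have hμ : MultilinearMap.alternatization μ = 0 := by
    refine Module.Basis.ext_alternating (Matrix.stdBasis C (Fin n) (Fin n)) fun v hv ↦ ?_
    have := Fintype.card_le_of_injective v hv
    simp only [Fintype.card_fin, Fintype.card_prod] at this
    omega
  have := congrArg (fun ν ↦ ν fun k ↦ f (k, 1)) hμ
  simpa [MultilinearMap.alternatization_apply, μ, prod_map_capelliWord, Units.smul_def,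
    mul_assoc] using this

/-- The Capelli polynomial of degree `m > n ^ 2` vanishes on the image of every representation
of an algebra that embeds in the `n × n` matrices over a commutative algebra. -/
theorem sum_sign_smul_prod_capelliWord_eq_zero {A B R : Type*} [NonUnitalRing A] [Module ℂ A]
    [IsScalarTower ℂ A A] [SMulCommClass ℂ A A] [NonUnitalCommRing B] [Module ℂ B]
    [IsScalarTower ℂ B B] [SMulCommClass ℂ B B] [Ring R] [Algebra ℂ R] {n m : ℕ}
    (hm : n * n < m) {θ : A →ₙₐ[ℂ] Matrix (Fin n) (Fin n) B} (hθ : Function.Injective θ)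
    (π : A →ₙₐ[ℂ] R) (f : Fin m × Fin 3 → A) :
    ∑ σ : Equiv.Perm (Fin m),
      (Equiv.Perm.sign σ : ℤ) • ((capelliWord σ).map fun i ↦ π (f i)).prod = 0 := by
  let θ' : A →ₙₐ[ℂ] Matrix (Fin n) (Fin n) (Unitization ℂ B) :=
    { toFun := fun a ↦ (θ a).map (Unitization.inr : B → Unitization ℂ B)
      map_smul' := fun c a ↦ by ext1 i j; simp
      map_zero' := by ext1 i j; simp
      map_add' := fun a b ↦ by ext1 i j; simp
      map_mul' := fun a b ↦ by
        ext1 i j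
        simp only [map_mul, Matrix.map_apply, Matrix.mul_apply]
        exact (map_sum (Unitization.inrNonUnitalAlgHom ℂ B) _ _).trans (by simp) }
  let z : Unitization ℂ A := ∑ σ : Equiv.Perm (Fin m),
    (Equiv.Perm.sign σ : ℤ) • ((capelliWord σ).map fun i ↦ (f i : Unitization ℂ A)).prod
  have hfst : z.fst = 0 := by
    change Unitization.fstHom ℂ A z = 0
    rw [map_sum_sign_smul_prod_capelliWord]
    refine Finset.sum_eq_zero fun σ _ ↦ ?_
    rw [List.prod_eq_zero, smul_zero]
    exact List.mem_map.2 ⟨(⟨0, by omega⟩, 0), mem_capelliWord _ _, by simp⟩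
  have hz : z = Unitization.inr z.snd := Unitization.ext hfst rfl
  have hθz : θ' z.snd = 0 := by
    have := map_sum_sign_smul_prod_capelliWord (Unitization.lift θ')
      fun i ↦ (f i : Unitization ℂ A)
    rw [Matrix.sum_sign_smul_prod_capelliWord hm] at this
    change Unitization.lift θ' z = 0 at this
    rw [hz] at this
    simpa using this
  have hz0 : z = 0 := by
    rw [hz, hθ (a₁ := z.snd) (a₂ := 0), Unitization.inr_zero]
    ext i j
    have := congrFun (congrFun hθz i) j
    rw [map_zero]
    exact Unitization.inr_injective this
  have := map_sum_sign_smul_prod_capelliWord (Unitization.lift π)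
      fun i ↦ (f i : Unitization ℂ A)
  change Unitization.lift π z = _ at this
  rw [hz0, map_zero] at this
  simpa using this.symm

open InnerProductSpace in
/-- The Capelli polynomial of degree `(d + 1) ^ 2` does not vanish on the bounded operators of a
Hilbert space with `d + 1` orthonormal vectors. -/
theorem Orthonormal.exists_sum_sign_smul_prod_capelliWord_ne_zero {H : Type*}
    [NormedAddCommGroup H] [InnerProductSpace ℂ H] {d : ℕ} {e : Fin (d + 1) → H}
    (he : Orthonormal ℂ e) : ∃ f : Fin ((d + 1) * (d + 1)) × Fin 3 → H →L[ℂ] H,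
      ∑ σ : Equiv.Perm (Fin ((d + 1) * (d + 1))),
        (Equiv.Perm.sign σ : ℤ) • ((capelliWord σ).map f).prod ≠ 0 := by
  classical
  let E : Fin (d + 1) → Fin (d + 1) → H →L[ℂ] H := fun i j ↦ rankOne ℂ (e i) (e j)
  have hE : ∀ i j k l, E i j * E k l = if j = k then E i l else 0 := fun i j k l ↦ by
    ext v
    have := he.1 k
    split_ifs with h
    · simp [E, h, this]
    · simp [E, he.2 h]
  let p : Fin ((d + 1) * (d + 1)) → Fin (d + 1) × Fin (d + 1) := finProdFinEquiv.symm
  have hp : ∀ k l, (p k).1 = (p l).1 → (p k).2 = (p l).2 → k = l := fun k l h₁ h₂ ↦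
    finProdFinEquiv.symm.injective (Prod.ext h₁ h₂)
  let f : Fin ((d + 1) * (d + 1)) × Fin 3 → H →L[ℂ] H := fun i ↦
    ![E 0 (p i.1).1, E (p i.1).1 (p i.1).2, E (p i.1).2 0] i.2
  have hf : ∀ k l, f (k, 0) * f (l, 1) * f (k, 2) = if k = l then E 0 0 else 0 := fun k l ↦ by
    simp only [f, Matrix.cons_val]
    by_cases h : k = l
    · simp [h, hE]
    · rw [if_neg h, hE]
      split_ifs with h₁
      · rw [hE, if_neg fun h₂ ↦ h (hp k l h₁ h₂.symm)]
      · rw [zero_mul]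
  refine ⟨f, fun h ↦ ?_⟩
  rw [Finset.sum_eq_single 1, prod_map_capelliWord] at h
  · simp only [Equiv.Perm.sign_one, Units.val_one, one_smul, Equiv.Perm.coe_one, id_eq, hf,
      if_true, List.ofFn_const, List.prod_replicate] at h
    have hidem : IsIdempotentElem (E 0 0) := by simp [IsIdempotentElem, hE]
    rw [hidem.pow_eq (by simp)] at h
    have := congrArg (fun T : H →L[ℂ] H ↦ T (e 0)) h
    simp [E, he.1] at this
    exact he.ne_zero 0 this
  · intro σ _ hσ
    obtain ⟨k, hk⟩ : ∃ k, k ≠ σ k := by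
      by_contra! hc
      exact hσ (Equiv.ext fun k ↦ (hc k).symm)
    rw [prod_map_capelliWord, List.prod_eq_zero, smul_zero]
    exact List.mem_ofFn.2 ⟨k, by rw [hf, if_neg hk]⟩
  · simp

theorem MatrixEmbeddingWitness.isSubhomogeneous {n : ℕ} {A : Type} [NonUnitalCStarAlgebra A]
    (W : MatrixEmbeddingWitness n A) : IsSubhomogeneous n A := by
  intro H _ _ _ π hπ
  by_contra! hlt
  let _ := W.instB
  let _ : NonUnitalCommRing W.B := { W.instB with mul_comm := W.comm }
  have hle : ((n + 1 : ℕ) : Cardinal) ≤ Module.rank ℂ H := by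
    rw [Nat.cast_succ]
    exact Cardinal.natCast_add_one_le_iff.2 hlt
  obtain ⟨v, hv⟩ := exists_linearIndependent_of_le_rank hle
  obtain ⟨f, hf⟩ := (InnerProductSpace.gramSchmidtNormed_orthonormal
    hv).exists_sum_sign_smul_prod_capelliWord_ne_zero
  exact hf <| hπ.sum_smul_prod_eq_zero nodup_capelliWord mem_capelliWord
    (fun g ↦ sum_sign_smul_prod_capelliWord_eq_zero (by nlinarith)
      (θ := W.θ.toNonUnitalAlgHom) W.inj π.toNonUnitalAlgHom g) f

end Capelli

/-- A C*-algebra `A` is `n`-subhomogeneous if and only if it embeds as a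
C*-subalgebra of `Mₙ(B)` for some abelian C*-algebra `B`. -/
theorem stmt5 (n : ℕ) (hn : 1 ≤ n) (A : Type) [NonUnitalCStarAlgebra A] :
    IsSubhomogeneous n A ↔ Nonempty (MatrixEmbeddingWitness n A) :=
  ⟨fun h ↦ h.nonempty_matrixEmbeddingWitness, fun ⟨W⟩ ↦ W.isSubhomogeneous⟩

end
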